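/- arXiv:2002.05424 — 8 statements merged into one kernel-verified Lean document; each statement's English description precedes it below -/
import Mathlib

section
/- (Fisher consistency) Let Z be compact and let Δ : Z × Y → ℝ admit an ILE with Hilbert space H and maps ψ : Z → H, φ : Y → H. Let ρ be a Borel probability measure on X × Y, let g*(x) = ∫_Y φ(y) dρ(y|x), and let f* : X → Z be a measurable minimizer of the expected risk E(f) = ∫ Δ(f(x), y) dρ(x,y). Then f*(x) ∈ argmin_{z ∈ Z} ⟨ψ(z), g*(x)⟩_H for ρ_X-almost every x; equivalently, any measurable f : X → Z satisfying f(x) ∈ argmin_{z ∈ Z} ⟨ψ(z), g*(x)⟩_H for ρ_X-almost every x attains the minimum of E. -/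
open MeasureTheory RealInnerProductSpace

section ImplicitLossEmbedding

variable {X Y Z H : Type*} [MeasurableSpace X] [MeasurableSpace Y] [NormedAddCommGroup H]
  [TopologicalSpace.SeparableSpace H] [MeasurableSpace H] [BorelSpace H]
  {ψ : Z → H} {φ : Y → H}

/-- A bounded measurable embedding is integrable for any finite measure. -/
lemma integrable_embedding (hφ : Measurable φ) (hφ1 : ∀ y, ‖φ y‖ ≤ 1)
    (μ : Measure Y) [IsFiniteMeasure μ] : Integrable φ μ :=
  have : SecondCountableTopology H := UniformSpace.secondCountable_of_separable H
  .of_bound hφ.aestronglyMeasurable 1 (.of_forall hφ1)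

variable [InnerProductSpace ℝ H]

/-- The conditional mean embedding `x ↦ g*(x)` is measurable. -/
lemma measurable_integral_condKernel [StandardBorelSpace Y] [Nonempty Y] (hφ : Measurable φ)
    (ρ : Measure (X × Y)) [IsFiniteMeasure ρ] :
    Measurable fun x => ∫ y, φ y ∂(ρ.condKernel x) := by
  have : SecondCountableTopology H := UniformSpace.secondCountable_of_separable H
  exact (hφ.stronglyMeasurable.integral_kernel (κ := ρ.condKernel)).measurable

/-- The conditional risk `x ↦ ⟪ψ (f x), g*(x)⟫` is integrable. -/
lemma integrable_inner_integral_condKernel [MeasurableSpace Z] [StandardBorelSpace Y]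
    [Nonempty Y] (hψ : Measurable ψ) (hφ : Measurable φ)
    (hφ1 : ∀ y, ‖φ y‖ ≤ 1) {C : ℝ} (hC : ∀ z, ‖ψ z‖ ≤ C) (ρ : Measure (X × Y))
    [IsProbabilityMeasure ρ] {f : X → Z} (hf : Measurable f) :
    Integrable (fun x => ⟪ψ (f x), ∫ y, φ y ∂(ρ.condKernel x)⟫) ρ.fst := by
  have : SecondCountableTopology H := UniformSpace.secondCountable_of_separable H
  refine .of_bound ((hψ.comp hf).inner
    (measurable_integral_condKernel hφ ρ)).aestronglyMeasurable C (.of_forall fun x => ?_)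
  have hg : ‖∫ y, φ y ∂(ρ.condKernel x)‖ ≤ 1 := by
    simpa using norm_integral_le_of_norm_le_const (μ := ρ.condKernel x) (.of_forall hφ1)
  calc _ ≤ ‖ψ (f x)‖ * ‖∫ y, φ y ∂(ρ.condKernel x)‖ := norm_inner_le_norm _ _
    _ ≤ ‖ψ (f x)‖ * 1 := by gcongr
    _ ≤ C := by simpa using hC (f x)

variable [CompleteSpace H]

/-- A loss with an implicit embedding, continuous in its first argument, has conditional risk
continuous in the prediction. -/
lemma continuous_inner_integral [TopologicalSpace Z] [FirstCountableTopology Z]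
    (hφ : Measurable φ) (hφ1 : ∀ y, ‖φ y‖ ≤ 1) {C : ℝ} (hC : ∀ z, ‖ψ z‖ ≤ C)
    (hcont : ∀ y, Continuous fun z => ⟪ψ z, φ y⟫) (μ : Measure Y) [IsFiniteMeasure μ] :
    Continuous fun z => ⟪ψ z, ∫ y, φ y ∂μ⟫ := by
  have hint := integrable_embedding hφ hφ1 μ
  simp_rw [← integral_inner hint]
  refine continuous_of_dominated (bound := fun _ => C)
    (fun z => (hint.const_inner (ψ z)).aestronglyMeasurable) (fun z => .of_forall fun y => ?_)
    (integrable_const C) (.of_forall hcont)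
  calc _ ≤ ‖ψ z‖ * ‖φ y‖ := norm_inner_le_norm _ _
    _ ≤ ‖ψ z‖ * 1 := by gcongr; exact hφ1 _
    _ ≤ C := by simpa using hC z

variable [MeasurableSpace Z] [StandardBorelSpace Y] [Nonempty Y]

/-- The expected risk is the integral of the conditional risk. -/
lemma integral_inner_eq_integral_condKernel (hψ : Measurable ψ) (hφ : Measurable φ)
    (hφ1 : ∀ y, ‖φ y‖ ≤ 1) {C : ℝ} (hC : ∀ z, ‖ψ z‖ ≤ C) (ρ : Measure (X × Y))
    [IsProbabilityMeasure ρ] {f : X → Z} (hf : Measurable f) :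
    ∫ p, ⟪ψ (f p.1), φ p.2⟫ ∂ρ =
      ∫ x, ⟪ψ (f x), ∫ y, φ y ∂(ρ.condKernel x)⟫ ∂ρ.fst := by
  have : SecondCountableTopology H := UniformSpace.secondCountable_of_separable H
  have hint : Integrable (fun p : X × Y => ⟪ψ (f p.1), φ p.2⟫) ρ := by
    refine .of_bound ((hψ.comp (hf.comp measurable_fst)).inner
      (hφ.comp measurable_snd)).aestronglyMeasurable C (.of_forall fun p => ?_)
    calc _ ≤ ‖ψ (f p.1)‖ * ‖φ p.2‖ := norm_inner_le_norm _ _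
      _ ≤ ‖ψ (f p.1)‖ * 1 := by gcongr; exact hφ1 _
      _ ≤ C := by simpa using hC (f p.1)
  rw [← Measure.integral_condKernel hint]
  exact integral_congr_ae (.of_forall fun x =>
    integral_inner (integrable_embedding hφ hφ1 (ρ.condKernel x)) (ψ (f x)))

/-- A measurable risk minimizer is, almost surely, no worse than any fixed prediction. -/
lemma ae_inner_le_of_forall_integral_le (hψ : Measurable ψ) (hφ : Measurable φ)
    (hφ1 : ∀ y, ‖φ y‖ ≤ 1) {C : ℝ} (hC : ∀ z, ‖ψ z‖ ≤ C) (ρ : Measure (X × Y))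
    [IsProbabilityMeasure ρ] {f : X → Z} (hf : Measurable f)
    (hmin : ∀ f' : X → Z, Measurable f' →
      ∫ p, ⟪ψ (f p.1), φ p.2⟫ ∂ρ ≤ ∫ p, ⟪ψ (f' p.1), φ p.2⟫ ∂ρ) (z : Z) :
    ∀ᵐ x ∂ρ.fst, ⟪ψ (f x), ∫ y, φ y ∂(ρ.condKernel x)⟫ ≤
      ⟪ψ z, ∫ y, φ y ∂(ρ.condKernel x)⟫ := by
  classical
  have : SecondCountableTopology H := UniformSpace.secondCountable_of_separable H
  set g : X → H := fun x => ∫ y, φ y ∂(ρ.condKernel x) with hg_def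
  have hg : Measurable g := measurable_integral_condKernel hφ ρ
  have hs : MeasurableSet {x | ⟪ψ z, g x⟫ < ⟪ψ (f x), g x⟫} :=
    measurableSet_lt (measurable_const.inner hg) ((hψ.comp hf).inner hg)
  let f' : X → Z := fun x => if ⟪ψ z, g x⟫ < ⟪ψ (f x), g x⟫ then z else f x
  have hf' : Measurable f' := Measurable.ite hs measurable_const hf
  have hle := hmin f' hf'
  rw [integral_inner_eq_integral_condKernel hψ hφ hφ1 hC ρ hf,
    integral_inner_eq_integral_condKernel hψ hφ hφ1 hC ρ hf'] at hle
  have hi := integrable_inner_integral_condKernel hψ hφ hφ1 hC ρ hf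
  have hi' := integrable_inner_integral_condKernel hψ hφ hφ1 hC ρ hf'
  have hpt : ∀ x, ⟪ψ (f' x), g x⟫ ≤ ⟪ψ (f x), g x⟫ := fun x => by
    by_cases h : ⟪ψ z, g x⟫ < ⟪ψ (f x), g x⟫
    · simpa [f', h] using h.le
    · simp [f', h]
  have hae := (integral_eq_iff_of_ae_le hi' hi (.of_forall hpt)).1
    (le_antisymm (integral_mono hi' hi hpt) hle)
  filter_upwards [hae] with x hx
  by_contra! h
  simp only [hg_def, f'] at hx h
  rw [if_pos h] at hx
  exact h.ne hx

end ImplicitLossEmbedding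

/-- Fisher consistency: let `Δ` be a continuous loss admitting an ILE with
Hilbert space `H` and maps `ψ, φ`, `Z` compact Polish, and let
`g*(x) = ∫ φ(y) dρ(y|x)`. Then any measurable minimizer `f*` of the expected risk
`E(f) = ∫ Δ(f x, y) dρ` satisfies `f*(x) ∈ argmin_z ⟪ψ z, g*(x)⟫` for `ρ_X`-a.e. `x`;
conversely, any measurable `f` with `f(x) ∈ argmin_z ⟪ψ z, g*(x)⟫` a.e. attains the
minimum of `E`. -/
theorem stmt3
    {X Y Z H : Type*}
    [MeasurableSpace X] [TopologicalSpace X] [PolishSpace X] [BorelSpace X]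
    [TopologicalSpace Y] [PolishSpace Y] [MeasurableSpace Y] [BorelSpace Y] [Nonempty Y]
    [TopologicalSpace Z] [PolishSpace Z] [MeasurableSpace Z] [BorelSpace Z]
    [CompactSpace Z] [Nonempty Z]
    [NormedAddCommGroup H] [InnerProductSpace ℝ H] [CompleteSpace H]
    [TopologicalSpace.SeparableSpace H] [MeasurableSpace H] [BorelSpace H]
    (ψ : Z → H) (φ : Y → H) (hψ : Measurable ψ) (hφ : Measurable φ)
    (hφ1 : ∀ y, ‖φ y‖ ≤ 1) (hψbdd : ∃ C : ℝ, ∀ z, ‖ψ z‖ ≤ C)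
    (Δ : Z → Y → ℝ) (hΔc : Continuous fun p : Z × Y => Δ p.1 p.2)
    (hΔ : ∀ z y, Δ z y = ⟪ψ z, φ y⟫)
    (ρ : Measure (X × Y)) [IsProbabilityMeasure ρ] :
    (∀ fstar : X → Z, Measurable fstar →
      (∀ f : X → Z, Measurable f →
        ∫ p, Δ (fstar p.1) p.2 ∂ρ ≤ ∫ p, Δ (f p.1) p.2 ∂ρ) →
      ∀ᵐ x ∂ρ.fst, ∀ z : Z,
        ⟪ψ (fstar x), ∫ y, φ y ∂(ρ.condKernel x)⟫ ≤
          ⟪ψ z, ∫ y, φ y ∂(ρ.condKernel x)⟫) ∧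
    (∀ f : X → Z, Measurable f →
      (∀ᵐ x ∂ρ.fst, ∀ z : Z,
        ⟪ψ (f x), ∫ y, φ y ∂(ρ.condKernel x)⟫ ≤
          ⟪ψ z, ∫ y, φ y ∂(ρ.condKernel x)⟫) →
      ∀ f' : X → Z, Measurable f' →
        ∫ p, Δ (f p.1) p.2 ∂ρ ≤ ∫ p, Δ (f' p.1) p.2 ∂ρ) := by
  have : SecondCountableTopology H := UniformSpace.secondCountable_of_separable H
  obtain ⟨C, hC⟩ := hψbdd
  have hcont : ∀ y, Continuous fun z => ⟪ψ z, φ y⟫ := fun y => by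
    simpa only [hΔ, Function.comp_def] using hΔc.comp (Continuous.prodMk_left y)
  simp only [hΔ]
  refine ⟨fun f hf hmin => ?_, fun f hf hmin f' hf' => ?_⟩
  · obtain ⟨s, hs, hsd⟩ := TopologicalSpace.exists_countable_dense Z
    have hae := (ae_ball_iff hs).2 fun z _ =>
      ae_inner_le_of_forall_integral_le hψ hφ hφ1 hC ρ hf hmin z
    filter_upwards [hae] with x hx z
    have hclosed := isClosed_le
      (continuous_const (y := ⟪ψ (f x), ∫ y, φ y ∂(ρ.condKernel x)⟫))
      (continuous_inner_integral hφ hφ1 hC hcont (ρ.condKernel x))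
    exact hclosed.closure_subset_iff.2 hx (hsd z)
  · rw [integral_inner_eq_integral_condKernel hψ hφ hφ1 hC ρ hf,
      integral_inner_eq_integral_condKernel hψ hφ hφ1 hC ρ hf']
    refine integral_mono_ae (integrable_inner_integral_condKernel hψ hφ hφ1 hC ρ hf)
      (integrable_inner_integral_condKernel hψ hφ hφ1 hC ρ hf') ?_
    filter_upwards [hmin] with x hx using hx (f' x)
end

section
/- (Equivalence of ILE definitions) Let Y be a Polish space and Δ : Y × Y → ℝ. Then Δ admits an ILE if and only if there exist a separable real Hilbert space H₀, a continuous bounded map ζ : Y → H₀, and a bounded linear operator V : H₀ → H₀ such that Δ(z, y) = ⟨ζ(z), V ζ(y)⟩_{H₀} for all z, y ∈ Y. -/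
open RealInnerProductSpace

noncomputable section

/-- An Implicit Loss Embedding (ILE) of the loss `Δ : Z → Y → ℝ` with constant bound `c`:
a separable real Hilbert space `H` together with measurable bounded maps `ψ : Z → H` and
`φ : Y → H` with `‖φ y‖ ≤ 1`, `‖ψ z‖ ≤ c` and `Δ z y = ⟪ψ z, φ y⟫`. -/
structure ILEWith {Z Y : Type*} [MeasurableSpace Z] [MeasurableSpace Y]
    (Δ : Z → Y → ℝ) (c : ℝ) where
  H : Type
  [normgrp : NormedAddCommGroup H]
  [innsp : InnerProductSpace ℝ H]
  [cpl : CompleteSpace H]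
  [sep : TopologicalSpace.SeparableSpace H]
  [mH : MeasurableSpace H]
  [bH : BorelSpace H]
  ψ : Z → H
  φ : Y → H
  meas_ψ : Measurable ψ
  meas_φ : Measurable φ
  norm_φ : ∀ y, ‖φ y‖ ≤ 1
  norm_ψ : ∀ z, ‖ψ z‖ ≤ c
  loss_eq : ∀ z y, Δ z y = ⟪ψ z, φ y⟫

/-- A loss `Δ` admits an ILE with continuous feature maps. -/
def AdmitsContILE {Z Y : Type*} [TopologicalSpace Z] [TopologicalSpace Y]
    [MeasurableSpace Z] [MeasurableSpace Y] (Δ : Z → Y → ℝ) : Prop :=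
  ∃ c : ℝ, ∃ e : ILEWith Δ c,
    letI := e.normgrp
    Continuous e.ψ ∧ Continuous e.φ

/-- The alternative ILE representation of `Δ : Y × Y → ℝ` from `ciliberto2016`: a separable
real Hilbert space `H₀`, a continuous bounded map `ζ : Y → H₀` and a bounded linear operator
`V : H₀ → H₀` with `Δ(z,y) = ⟪ζ z, V (ζ y)⟫`. -/
structure KernelILE {Y : Type*} [TopologicalSpace Y] (Δ : Y → Y → ℝ) where
  H : Type
  [normgrp : NormedAddCommGroup H]
  [innsp : InnerProductSpace ℝ H]
  [cpl : CompleteSpace H]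
  [sep : TopologicalSpace.SeparableSpace H]
  ζ : Y → H
  V : H →L[ℝ] H
  cont_ζ : Continuous ζ
  bdd_ζ : ∃ C : ℝ, ∀ y, ‖ζ y‖ ≤ C
  loss_eq : ∀ z y, Δ z y = ⟪ζ z, V (ζ y)⟫

/-- The bounded operator `(a, b) ↦ (b, 0)` on the Hilbert sum of two copies of `H`. -/
def sndToFst (H : Type*) [NormedAddCommGroup H] [InnerProductSpace ℝ H] :
    WithLp 2 (H × H) →L[ℝ] WithLp 2 (H × H) :=
  ((WithLp.prodContinuousLinearEquiv 2 ℝ H H).symm : H × H →L[ℝ] WithLp 2 (H × H)) ∘L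
    (ContinuousLinearMap.inl ℝ H H) ∘L (ContinuousLinearMap.snd ℝ H H) ∘L
    ((WithLp.prodContinuousLinearEquiv 2 ℝ H H) : WithLp 2 (H × H) →L[ℝ] H × H)

lemma inner_sndToFst {H : Type*} [NormedAddCommGroup H] [InnerProductSpace ℝ H]
    (x y : WithLp 2 (H × H)) : ⟪x, sndToFst H y⟫ = ⟪x.fst, y.snd⟫ := by
  simp [sndToFst, WithLp.prod_inner_apply]

/-- Pairing the two continuous feature maps of an ILE gives a kernel representation on the
Hilbert sum of two copies of the feature space. -/
def ILEWith.toKernelILE {Y : Type*} [TopologicalSpace Y] [MeasurableSpace Y]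
    {Δ : Y → Y → ℝ} {c : ℝ} (e : ILEWith Δ c)
    (hψ : letI := e.normgrp; Continuous e.ψ) (hφ : letI := e.normgrp; Continuous e.φ) :
    KernelILE Δ :=
  letI := e.normgrp
  letI := e.innsp
  haveI := e.cpl
  haveI := e.sep
  { H := WithLp 2 (e.H × e.H)
    sep := (WithLp.homeomorphProd 2 e.H e.H).symm.surjective.denseRange.separableSpace
      (WithLp.homeomorphProd 2 e.H e.H).symm.continuous
    ζ := fun y => WithLp.toLp 2 (e.ψ y, e.φ y)
    V := sndToFst e.H
    cont_ζ := (WithLp.prod_continuous_toLp 2 e.H e.H).comp (hψ.prodMk hφ)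
    bdd_ζ := by
      refine ⟨√(c ^ 2 + 1 ^ 2), fun y => ?_⟩
      rw [WithLp.prod_norm_eq_of_L2]
      gcongr
      · exact e.norm_ψ y
      · exact e.norm_φ y
    loss_eq := fun z y => (e.loss_eq z y).trans
      (inner_sndToFst (WithLp.toLp 2 (e.ψ z, e.φ z)) (WithLp.toLp 2 (e.ψ y, e.φ y))).symm }

/-- Moving `V` to the other side of the inner product and rescaling turns a kernel
representation into an ILE. -/
lemma KernelILE.admitsContILE {Y : Type*} [TopologicalSpace Y] [MeasurableSpace Y]
    [OpensMeasurableSpace Y] {Δ : Y → Y → ℝ} (k : KernelILE Δ) : AdmitsContILE Δ := by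
  let := k.normgrp
  let := k.innsp
  have := k.cpl
  have := k.sep
  let : MeasurableSpace k.H := borel k.H
  have : BorelSpace k.H := ⟨rfl⟩
  obtain ⟨C, hC⟩ := k.bdd_ζ
  obtain ⟨D, hD, hCD⟩ : ∃ D : ℝ, 0 < D ∧ C ≤ D :=
    ⟨max C 1, lt_max_of_lt_right one_pos, le_max_left _ _⟩
  have hζ : ∀ y, ‖k.ζ y‖ ≤ D := fun y => (hC y).trans hCD
  let A : k.H →L[ℝ] k.H := ContinuousLinearMap.adjoint k.V
  have cψ : Continuous fun z => D • A (k.ζ z) := (A.continuous.comp k.cont_ζ).const_smul D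
  have cφ : Continuous fun y => D⁻¹ • k.ζ y := k.cont_ζ.const_smul D⁻¹
  refine ⟨D * (‖A‖ * D), ⟨k.H, fun z => D • A (k.ζ z), fun y => D⁻¹ • k.ζ y,
    cψ.measurable, cφ.measurable, fun y => ?_, fun z => ?_, fun z y => ?_⟩, cψ, cφ⟩
  · rw [norm_smul, norm_inv, Real.norm_of_nonneg hD.le, inv_mul_le_iff₀ hD, mul_one]
    exact hζ y
  · rw [norm_smul, Real.norm_of_nonneg hD.le]
    gcongr
    exact A.le_opNorm_of_le (hζ z)
  · rw [k.loss_eq, real_inner_smul_left, real_inner_smul_right, mul_inv_cancel_left₀ hD.ne',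
      ContinuousLinearMap.adjoint_inner_left]

/-- a loss `Δ : Y × Y → ℝ` on a Polish space admits an ILE (with continuous
feature maps) if and only if it can be written as `Δ(z,y) = ⟪ζ z, V (ζ y)⟫` for a continuous
bounded map `ζ` into a separable Hilbert space and a bounded linear operator `V`. -/
theorem stmt6 {Y : Type*}
    [TopologicalSpace Y] [PolishSpace Y] [MeasurableSpace Y] [BorelSpace Y]
    (Δ : Y → Y → ℝ) :
    AdmitsContILE Δ ↔ Nonempty (KernelILE Δ) := by
  constructor
  · rintro ⟨c, e, hψ, hφ⟩
    exact ⟨e.toKernelILE hψ hφ⟩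
  · rintro ⟨k⟩
    exact k.admitsContILE
end
end

section
/- (KDE loss admits an ILE) Let Y be a compact Polish space, H₀ a separable real Hilbert space, and κ : Y → H₀ a continuous map with sup_{y ∈ Y} ‖κ(y)‖_{H₀}² = η² < ∞; let h(z, y) = ⟨κ(z), κ(y)⟩_{H₀} be the induced reproducing kernel. Then the loss Δ : Y × Y → ℝ defined by Δ(z, y) = h(z,z) + h(y,y) − 2 h(z,y) = ‖κ(z) − κ(y)‖_{H₀}² admits an ILE with constant c_Δ ≤ 2(2η⁴ + 1). -/
open RealInnerProductSpace

noncomputable section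

/-- An orthonormal family in a separable inner product space is countable. -/
theorem Orthonormal.countable_of_separableSpace {ι E : Type*} [NormedAddCommGroup E]
    [InnerProductSpace ℝ E] [TopologicalSpace.SeparableSpace E] {v : ι → E}
    (hv : Orthonormal ℝ v) : Countable ι := by
  refine Pairwise.countable_of_isOpen_disjoint (s := fun i => Metric.ball (v i) (1 / 2))
    (fun i j hij => Metric.ball_disjoint_ball ?_) (fun i => Metric.isOpen_ball)
    (fun i => Metric.nonempty_ball.2 (by norm_num))
  have h : ‖v i - v j‖ ^ 2 = 2 := by
    rw [norm_sub_sq_real, hv.1 i, hv.1 j, hv.2 hij]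
    norm_num
  rw [dist_eq_norm]
  nlinarith [norm_nonneg (v i - v j)]

/-- Every separable real Hilbert space is isometric to some `ℓ²(ι, ℝ)` with `ι` in the lowest
universe. -/
theorem exists_linearIsometryEquiv_lp_two (E : Type*) [NormedAddCommGroup E]
    [InnerProductSpace ℝ E] [CompleteSpace E] [TopologicalSpace.SeparableSpace E] :
    ∃ ι : Type, Nonempty (E ≃ₗᵢ[ℝ] lp (fun _ : ι => ℝ) 2) := by
  obtain ⟨w, b, -⟩ := exists_hilbertBasis ℝ E
  have : Countable w := b.orthonormal.countable_of_separableSpace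
  let e := equivShrink.{0} w
  refine ⟨Shrink.{0} w, ⟨(HilbertBasis.mk (b.orthonormal.comp e.symm e.symm.injective) ?_).repr⟩⟩
  rw [e.symm.surjective.range_comp]
  exact b.dense_span.ge

/-- An implicit loss embedding into a separable real Hilbert space of any universe, given by
continuous maps, yields one in the sense of `ILEWith`. -/
theorem ILEWith.nonempty_of_continuous {Z Y E : Type*} [TopologicalSpace Z] [MeasurableSpace Z]
    [OpensMeasurableSpace Z] [TopologicalSpace Y] [MeasurableSpace Y] [OpensMeasurableSpace Y]
    [NormedAddCommGroup E] [InnerProductSpace ℝ E] [CompleteSpace E]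
    [TopologicalSpace.SeparableSpace E] {Δ : Z → Y → ℝ} {c : ℝ} {ψ : Z → E} {φ : Y → E}
    (hψ : Continuous ψ) (hφ : Continuous φ) (norm_φ : ∀ y, ‖φ y‖ ≤ 1) (norm_ψ : ∀ z, ‖ψ z‖ ≤ c)
    (loss_eq : ∀ z y, Δ z y = ⟪ψ z, φ y⟫) : Nonempty (ILEWith Δ c) := by
  obtain ⟨ι, ⟨e⟩⟩ := exists_linearIsometryEquiv_lp_two E
  let _ : MeasurableSpace (lp (fun _ : ι => ℝ) 2) := borel _
  have : BorelSpace (lp (fun _ : ι => ℝ) 2) := ⟨rfl⟩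
  have : TopologicalSpace.SeparableSpace (lp (fun _ : ι => ℝ) 2) :=
    e.surjective.denseRange.separableSpace e.continuous
  exact ⟨{ H := lp (fun _ : ι => ℝ) 2
           ψ := fun z => e (ψ z)
           φ := fun y => e (φ y)
           meas_ψ := (e.continuous.comp hψ).measurable
           meas_φ := (e.continuous.comp hφ).measurable
           norm_φ := fun y => by simpa using norm_φ y
           norm_ψ := fun z => by simpa using norm_ψ z
           loss_eq := fun z y => by rw [loss_eq, e.inner_map_map] }⟩

/-- The vector `(a, x, b)` of the Hilbert sum `ℝ ⊕ E ⊕ ℝ`. -/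
def hilbertTriple {E : Type*} (a : ℝ) (x : E) (b : ℝ) : WithLp 2 (ℝ × WithLp 2 (E × ℝ)) :=
  WithLp.toLp 2 (a, WithLp.toLp 2 (x, b))

theorem inner_hilbertTriple {E : Type*} [NormedAddCommGroup E] [InnerProductSpace ℝ E]
    (a a' b b' : ℝ) (x x' : E) :
    ⟪hilbertTriple a x b, hilbertTriple a' x' b'⟫ = a * a' + (⟪x, x'⟫ + b * b') := by
  simp [hilbertTriple, WithLp.prod_inner_apply, mul_comm]

theorem norm_hilbertTriple_sq {E : Type*} [NormedAddCommGroup E] [InnerProductSpace ℝ E]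
    (a b : ℝ) (x : E) : ‖hilbertTriple a x b‖ ^ 2 = a ^ 2 + (‖x‖ ^ 2 + b ^ 2) := by
  rw [← real_inner_self_eq_norm_sq, inner_hilbertTriple, real_inner_self_eq_norm_sq]
  ring

@[fun_prop]
theorem continuous_hilbertTriple {X E : Type*} [TopologicalSpace X] [TopologicalSpace E]
    {a b : X → ℝ} {x : X → E} (ha : Continuous a) (hx : Continuous x) (hb : Continuous b) :
    Continuous fun t => hilbertTriple (a t) (x t) (b t) := by
  unfold hilbertTriple
  fun_prop

/-- the Kernel Dependency Estimation loss `Δ(z,y) = ‖κ z − κ y‖² =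
h(z,z) + h(y,y) − 2 h(z,y)` induced by a continuous bounded kernel feature map `κ` on a
compact Polish space admits an ILE with constant at most `2(2η⁴ + 1)`,
where `η² = sup_y ‖κ y‖²`. -/
theorem stmt10 {Y H₀ : Type*}
    [TopologicalSpace Y] [PolishSpace Y] [MeasurableSpace Y] [BorelSpace Y]
    [CompactSpace Y] [Nonempty Y]
    [NormedAddCommGroup H₀] [InnerProductSpace ℝ H₀] [CompleteSpace H₀]
    [TopologicalSpace.SeparableSpace H₀]
    (κ : Y → H₀) (hκ : Continuous κ)
    (η : ℝ) (hη : (⨆ y : Y, ‖κ y‖ ^ 2) = η ^ 2) :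
    Nonempty (ILEWith (fun z y : Y => ‖κ z - κ y‖ ^ 2) (2 * (2 * η ^ 4 + 1))) := by
  have hle (y : Y) : ‖κ y‖ ^ 2 ≤ η ^ 2 :=
    hη ▸ le_ciSup (isCompact_range (hκ.norm.pow 2)).bddAbove y
  have hpos : 0 < 1 + η ^ 2 := by positivity
  have hsqrt : √(2 : ℝ) ^ 2 = 2 := Real.sq_sqrt zero_le_two
  have hnorm_φ (y : Y) : ‖hilbertTriple 1 (√2 • κ y) (‖κ y‖ ^ 2)‖ ≤ 1 + η ^ 2 := by
    refine le_of_sq_le_sq ?_ hpos.le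
    rw [norm_hilbertTriple_sq, norm_smul, mul_pow, Real.norm_eq_abs, sq_abs, hsqrt]
    nlinarith [hle y, sq_nonneg ‖κ y‖]
  have hnorm_ψ (z : Y) : ‖hilbertTriple (‖κ z‖ ^ 2) (-(√2 • κ z)) 1‖ ≤ 1 + η ^ 2 := by
    refine le_of_sq_le_sq ?_ hpos.le
    rw [norm_hilbertTriple_sq, norm_neg, norm_smul, mul_pow, Real.norm_eq_abs, sq_abs, hsqrt]
    nlinarith [hle z, sq_nonneg ‖κ z‖]
  refine ILEWith.nonempty_of_continuous
    (ψ := fun z => (1 + η ^ 2) • hilbertTriple (‖κ z‖ ^ 2) (-(√2 • κ z)) 1)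
    (φ := fun y => (1 + η ^ 2)⁻¹ • hilbertTriple 1 (√2 • κ y) (‖κ y‖ ^ 2))
    (by fun_prop) (by fun_prop) (fun y => ?_) (fun z => ?_) (fun z y => ?_)
  · rw [norm_smul, Real.norm_of_nonneg (inv_nonneg.2 hpos.le), inv_mul_le_one₀ hpos]
    exact hnorm_φ y
  · rw [norm_smul, Real.norm_of_nonneg hpos.le]
    calc (1 + η ^ 2) * _ ≤ (1 + η ^ 2) * (1 + η ^ 2) := by gcongr; exact hnorm_ψ z
      _ ≤ 2 * (2 * η ^ 4 + 1) := by nlinarith [sq_nonneg (η ^ 2 - 1), sq_nonneg (η ^ 2)]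
  · rw [real_inner_smul_left, real_inner_smul_right, mul_inv_cancel_left₀ hpos.ne',
      inner_hilbertTriple, inner_neg_left, real_inner_smul_left, real_inner_smul_right,
      norm_sub_sq_real]
    linear_combination ⟪κ z, κ y⟫ * hsqrt
end
end

section
/- (Hölder losses in one dimension admit an ILE) Let Y = Z = [−B, B] with B > 0, and let Δ : Y × Y → ℝ be α-Hölder continuous with exponent α > 1/2, i.e. there exists L > 0 such that |Δ(z,y) − Δ(z',y')| ≤ L (|z − z'| + |y − y'|)^α for all z, z', y, y' ∈ Y. Then Δ admits an ILE. -/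
open RealInnerProductSpace

noncomputable section

open Filter Topology

lemma separableSpace_lp_two (ι : Type*) [Countable ι] :
    TopologicalSpace.SeparableSpace (lp (fun _ : ι => ℝ) 2) := by
  classical
  let S : Set (lp (fun _ : ι => ℝ) 2) := Set.range fun i => lp.single 2 i (1 : ℝ)
  have hS : TopologicalSpace.IsSeparable (Submodule.span ℝ S : Set (lp (fun _ : ι => ℝ) 2)) :=
    (Set.countable_range _).isSeparable.span
  rw [← TopologicalSpace.isSeparable_univ_iff]
  refine hS.closure.mono fun f _ => ?_
  refine mem_closure_of_tendsto (lp.hasSum_single (by simp) f) (Eventually.of_forall fun s => ?_)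
  refine Submodule.sum_mem _ fun i _ => ?_
  have : lp.single (E := fun _ : ι => ℝ) 2 i (f i) =
      f i • lp.single (E := fun _ : ι => ℝ) 2 i (1 : ℝ) := by
    rw [← lp.single_smul]; simp
  rw [this]
  exact Submodule.smul_mem _ _ (Submodule.subset_span ⟨i, rfl⟩)

/-- A map into `ℓ²` over a countable index type is measurable as soon as its coordinates are. -/
lemma measurable_lp_two_of_coord {ι X : Type*} [Countable ι] [MeasurableSpace X]
    [MeasurableSpace (lp (fun _ : ι => ℝ) 2)] [BorelSpace (lp (fun _ : ι => ℝ) 2)]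
    (f : X → lp (fun _ : ι => ℝ) 2) (hf : ∀ i, Measurable fun x => f x i) : Measurable f := by
  classical
  have := separableSpace_lp_two ι
  have := UniformSpace.secondCountable_of_separable (lp (fun _ : ι => ℝ) 2)
  refine measurable_of_tendsto_metrizable' (u := (atTop : Filter (Finset ι)))
    (f := fun s x => ∑ i ∈ s, lp.single 2 i (f x i)) (fun s => ?_) ?_
  · refine Finset.measurable_fun_sum s fun i _ => ?_
    exact (lp.isometry_single i).continuous.measurable.comp (hf i)
  · rw [tendsto_pi_nhds]
    intro x
    exact lp.hasSum_single (by simp) (f x)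

lemma memℓp_two_of_summable_sq {ι : Type*} {f : ι → ℝ} (hf : Summable fun i => f i ^ 2) :
    Memℓp (E := fun _ : ι => ℝ) f 2 := by
  rw [memℓp_gen_iff (by simp)]
  simpa using hf

lemma norm_lp_two_le {ι : Type*} {f : lp (fun _ : ι => ℝ) 2} {c : ℝ} (hc : 0 ≤ c)
    (hf : ∑' i, f i ^ 2 ≤ c ^ 2) : ‖f‖ ≤ c := by
  have h := lp.norm_rpow_eq_tsum (p := 2) (by simp) f
  simp only [ENNReal.toReal_ofNat, Real.rpow_ofNat, Real.norm_eq_abs, sq_abs] at h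
  exact le_of_sq_le_sq (h ▸ hf) hc

/-- A loss given by a series of products of square-summable measurable features admits an ILE. -/
lemma nonempty_ILEWith_of_hasSum {Z Y : Type*} [MeasurableSpace Z] [MeasurableSpace Y]
    {ι : Type} [Countable ι] {Δ : Z → Y → ℝ} {c : ℝ} (hc : 0 ≤ c)
    (a : ι → Z → ℝ) (b : ι → Y → ℝ) (ha : ∀ i, Measurable (a i)) (hb : ∀ i, Measurable (b i))
    (ha_sum : ∀ z, Summable fun i => a i z ^ 2) (hb_sum : ∀ y, Summable fun i => b i y ^ 2)
    (ha_le : ∀ z, ∑' i, a i z ^ 2 ≤ c ^ 2) (hb_le : ∀ y, ∑' i, b i y ^ 2 ≤ 1)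
    (hΔ : ∀ z y, HasSum (fun i => a i z * b i y) (Δ z y)) : Nonempty (ILEWith Δ c) := by
  let _ : MeasurableSpace (lp (fun _ : ι => ℝ) 2) := borel _
  have : BorelSpace (lp (fun _ : ι => ℝ) 2) := ⟨rfl⟩
  have := separableSpace_lp_two ι
  exact ⟨{
    H := lp (fun _ : ι => ℝ) 2
    ψ := fun z => ⟨fun i => a i z, memℓp_two_of_summable_sq (ha_sum z)⟩
    φ := fun y => ⟨fun i => b i y, memℓp_two_of_summable_sq (hb_sum y)⟩
    meas_ψ := measurable_lp_two_of_coord _ ha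
    meas_φ := measurable_lp_two_of_coord _ hb
    norm_φ := fun y => norm_lp_two_le zero_le_one (by simpa using hb_le y)
    norm_ψ := fun z => norm_lp_two_le hc (ha_le z)
    loss_eq := fun z y => by
      rw [lp.inner_eq_tsum, ← (hΔ z y).tsum_eq]
      simp [mul_comm] }⟩

/-- The index at level `n` of the dyadic cell of `[-B, B]` containing `y`. -/
def dyadicCell (B : ℝ) (n : ℕ) (y : ℝ) : ℕ := ⌊(y + B) / (2 * B) * 2 ^ n⌋₊

/-- The left endpoint of the `k`-th dyadic cell of `[-B, B]` at level `n`. -/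
def dyadicNode {B : ℝ} (hB : 0 < B) (n k : ℕ) : Set.Icc (-B) B :=
  Set.projIcc (-B) B (by linarith) (-B + 2 * B * (k / 2 ^ n))

/-- The increment of `f` between consecutive dyadic levels on the `k`-th cell of level `n`. -/
def dyadicIncrement {B : ℝ} (hB : 0 < B) (f : Set.Icc (-B) B → ℝ) : ℕ → ℕ → ℝ
  | 0, k => f (dyadicNode hB 0 k)
  | n + 1, k => f (dyadicNode hB (n + 1) k) - f (dyadicNode hB n (k / 2))

lemma dyadicCell_succ_div_two (B : ℝ) (n : ℕ) (y : ℝ) :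
    dyadicCell B (n + 1) y / 2 = dyadicCell B n y := by
  unfold dyadicCell
  rw [← Nat.floor_div_ofNat]
  congr 1
  rw [pow_succ]
  ring

lemma dyadicCell_le {B : ℝ} (hB : 0 < B) (n : ℕ) (y : Set.Icc (-B) B) :
    dyadicCell B n y ≤ 2 ^ n := by
  refine Nat.floor_le_of_le ?_
  have h : ((y : ℝ) + B) / (2 * B) ≤ 1 := by
    rw [div_le_one (by positivity)]; linarith [y.2.2]
  push_cast
  exact mul_le_of_le_one_left (by positivity) h

lemma measurable_dyadicCell (B : ℝ) (n : ℕ) : Measurable (dyadicCell B n) :=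
  Nat.measurable_floor.comp (by fun_prop)

lemma sum_dyadicIncrement {B : ℝ} (hB : 0 < B) (f : Set.Icc (-B) B → ℝ) (n : ℕ) (y : ℝ) :
    ∑ i ∈ Finset.range (n + 1), dyadicIncrement hB f i (dyadicCell B i y) =
      f (dyadicNode hB n (dyadicCell B n y)) := by
  induction n with
  | zero => simp [dyadicIncrement]
  | succ n ih =>
    rw [Finset.sum_range_succ, ih]
    simp [dyadicIncrement, dyadicCell_succ_div_two]

lemma abs_projIcc_sub_le {a b : ℝ} (h : a ≤ b) (x y : ℝ) :
    |(Set.projIcc a b h x : ℝ) - Set.projIcc a b h y| ≤ |x - y| := by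
  have := (LipschitzWith.projIcc h).dist_le_mul x y
  simpa [Subtype.dist_eq, Real.dist_eq] using this

lemma abs_dyadicNode_sub_le {B : ℝ} (hB : 0 < B) (n k : ℕ) :
    |(dyadicNode hB (n + 1) k : ℝ) - dyadicNode hB n (k / 2)| ≤ 2 * B / 2 ^ (n + 1) := by
  refine (abs_projIcc_sub_le _ _ _).trans ?_
  have h : -B + 2 * B * (k / 2 ^ (n + 1)) - (-B + 2 * B * ((k / 2 : ℕ) / 2 ^ n)) =
      2 * B / 2 ^ (n + 1) * (k - 2 * (k / 2 : ℕ)) := by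
    rw [pow_succ]; field_simp; ring
  have hk : (k : ℝ) - 2 * (k / 2 : ℕ) = (k % 2 : ℕ) := by
    rw [sub_eq_iff_eq_add]; exact_mod_cast (Nat.mod_add_div k 2).symm
  have hk' : ((k % 2 : ℕ) : ℝ) ≤ 1 := by
    exact_mod_cast Nat.le_of_lt_succ (Nat.mod_lt k two_pos)
  rw [h, hk, abs_of_nonneg (by positivity)]
  exact mul_le_of_le_one_right (by positivity) hk'

lemma abs_dyadicNode_dyadicCell_sub_le {B : ℝ} (hB : 0 < B) (n : ℕ) (y : Set.Icc (-B) B) :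
    |(dyadicNode hB n (dyadicCell B n y) : ℝ) - y| ≤ 2 * B / 2 ^ n := by
  have hproj := abs_projIcc_sub_le (by linarith : -B ≤ B)
    (-B + 2 * B * ((dyadicCell B n y : ℝ) / 2 ^ n)) y
  rw [Set.projIcc_val] at hproj
  refine hproj.trans ?_
  set t : ℝ := ((y : ℝ) + B) / (2 * B) * 2 ^ n with ht
  have ht0 : 0 ≤ t := by
    have : 0 ≤ (y : ℝ) + B := by linarith [y.2.1]
    positivity
  have h : -B + 2 * B * ((dyadicCell B n y : ℝ) / 2 ^ n) - y =
      2 * B / 2 ^ n * (dyadicCell B n y - t) := by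
    rw [ht]; field_simp; ring
  have h1 : (dyadicCell B n y : ℝ) ≤ t := Nat.floor_le ht0
  have h2 : t < dyadicCell B n y + 1 := Nat.lt_floor_add_one t
  rw [h, abs_mul, abs_of_nonneg (by positivity : 0 ≤ 2 * B / 2 ^ n)]
  refine mul_le_of_le_one_right (by positivity) ?_
  rw [abs_le]
  constructor <;> linarith

/-- A uniformly bounded loss whose dyadic increments in `y` decay like `rⁿ` with `2 r² < 1`
admits an ILE. -/
lemma exists_ILEWith_of_dyadicIncrement_le {B : ℝ} (hB : 0 < B)
    {Δ : Set.Icc (-B) B → Set.Icc (-B) B → ℝ} {M r : ℝ} (hr : 0 < r)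
    (hr2 : 2 * r ^ 2 < 1) (hmeas : ∀ y, Measurable fun z => Δ z y)
    (hle : ∀ z n k, |dyadicIncrement hB (Δ z) n k| ≤ M * r ^ n)
    (hlim : ∀ z (y : Set.Icc (-B) B),
      Tendsto (fun n => Δ z (dyadicNode hB n (dyadicCell B n y))) atTop (𝓝 (Δ z y))) :
    ∃ c : ℝ, Nonempty (ILEWith Δ c) := by
  set q : ℝ := √2 * r with hq
  have hq0 : 0 < q := by positivity
  have hq2 : q ^ 2 = 2 * r ^ 2 := by rw [hq, mul_pow, Real.sq_sqrt (by norm_num)]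
  have hq1 : q < 1 := by nlinarith
  have hgeo : HasSum (fun n => q ^ n) (1 - q)⁻¹ := hasSum_geometric_of_lt_one hq0.le hq1
  have h1q : 0 < 1 - q := by linarith
  let w : ℕ → ℝ := fun n => √((1 - q) * q ^ n)
  have hw : ∀ n, 0 < w n := fun n => Real.sqrt_pos.2 (by positivity)
  have hw2 : ∀ n, w n ^ 2 = (1 - q) * q ^ n := fun n => Real.sq_sqrt (by positivity)
  let a : (Σ n : ℕ, Fin (2 ^ n + 1)) → Set.Icc (-B) B → ℝ :=
    fun i z => dyadicIncrement hB (Δ z) i.1 i.2 / w i.1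
  let b : (Σ n : ℕ, Fin (2 ^ n + 1)) → Set.Icc (-B) B → ℝ :=
    fun i y => if dyadicCell B i.1 y = i.2 then w i.1 else 0
  let cell : ∀ n, Set.Icc (-B) B → Fin (2 ^ n + 1) :=
    fun n y => ⟨dyadicCell B n y, Nat.lt_succ_of_le (dyadicCell_le hB n y)⟩
  have hb_eq : ∀ n (k : Fin (2 ^ n + 1)) y, b ⟨n, k⟩ y = if k = cell n y then w n else 0 := by
    intro n k y
    simp [b, cell, Fin.ext_iff, eq_comm]
  have ha : ∀ i, Measurable (a i) := by
    rintro ⟨n, k⟩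
    refine Measurable.div_const ?_ _
    cases n with
    | zero => exact hmeas _
    | succ n => exact (hmeas _).sub (hmeas _)
  have hb : ∀ i, Measurable (b i) := fun i =>
    Measurable.ite (measurableSet_eq_fun
      ((measurable_dyadicCell B i.1).comp measurable_subtype_coe) measurable_const)
      measurable_const measurable_const
  have hb_fib : ∀ y n, ∑' k : Fin (2 ^ n + 1), b ⟨n, k⟩ y ^ 2 = (1 - q) * q ^ n := by
    intro y n
    simp [hb_eq, ite_pow, hw2]
  have hb_sum : ∀ y, Summable fun i => b i y ^ 2 := fun y =>
    (summable_sigma_of_nonneg fun i => sq_nonneg _).2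
      ⟨fun n => Summable.of_finite, by simpa only [hb_fib] using hgeo.summable.mul_left (1 - q)⟩
  have hb_tsum : ∀ y, ∑' i, b i y ^ 2 ≤ 1 := by
    intro y
    rw [(hb_sum y).tsum_sigma' fun n => Summable.of_finite]
    simp only [hb_fib]
    rw [tsum_mul_left, hgeo.tsum_eq, mul_inv_cancel₀ h1q.ne']
  set K : ℝ := 2 * M ^ 2 / (1 - q) with hK
  have hK0 : 0 ≤ K := by positivity
  have ha_fib : ∀ z n, ∑' k : Fin (2 ^ n + 1), a ⟨n, k⟩ z ^ 2 ≤ K * q ^ n := by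
    intro z n
    rw [tsum_fintype]
    have hterm : ∀ k ∈ Finset.univ, a ⟨n, k⟩ z ^ 2 ≤ (M * r ^ n) ^ 2 / ((1 - q) * q ^ n) := by
      intro k _
      simp only [a, div_pow, hw2]
      exact div_le_div_of_nonneg_right
        (sq_le_sq' (neg_le_of_abs_le (hle z n k)) (le_of_abs_le (hle z n k))) (by positivity)
    refine (Finset.sum_le_card_nsmul _ _ _ hterm).trans ?_
    have hcard : ((2 ^ n + 1 : ℕ) : ℝ) ≤ 2 * 2 ^ n := by
      have : (1 : ℝ) ≤ 2 ^ n := one_le_pow₀ one_le_two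
      push_cast; linarith
    rw [Finset.card_univ, Fintype.card_fin, nsmul_eq_mul]
    calc ((2 ^ n + 1 : ℕ) : ℝ) * ((M * r ^ n) ^ 2 / ((1 - q) * q ^ n))
        ≤ 2 * 2 ^ n * ((M * r ^ n) ^ 2 / ((1 - q) * q ^ n)) := by gcongr
      _ = 2 * M ^ 2 / (1 - q) * ((2 * r ^ 2) ^ n / q ^ n) := by
          field_simp; ring
      _ = K * q ^ n := by
          rw [← hq2, hK, ← pow_mul, mul_comm 2 n, pow_mul, sq (q ^ n),
            mul_div_cancel_right₀ _ (by positivity)]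
  have ha_fib_summable : ∀ z, Summable fun n => ∑' k : Fin (2 ^ n + 1), a ⟨n, k⟩ z ^ 2 := fun z =>
    Summable.of_nonneg_of_le (fun n => tsum_nonneg fun k => sq_nonneg _) (ha_fib z)
      (hgeo.summable.mul_left K)
  have ha_sum : ∀ z, Summable fun i => a i z ^ 2 := fun z =>
    (summable_sigma_of_nonneg fun i => sq_nonneg _).2
      ⟨fun n => Summable.of_finite, ha_fib_summable z⟩
  have ha_tsum : ∀ z, ∑' i, a i z ^ 2 ≤ √(K * (1 - q)⁻¹) ^ 2 := by
    intro z
    rw [Real.sq_sqrt (by positivity), (ha_sum z).tsum_sigma' fun n => Summable.of_finite]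
    refine ((ha_fib_summable z).tsum_le_tsum (ha_fib z) (hgeo.summable.mul_left K)).trans ?_
    rw [tsum_mul_left, hgeo.tsum_eq]
  refine ⟨√(K * (1 - q)⁻¹), nonempty_ILEWith_of_hasSum (Real.sqrt_nonneg _) a b ha hb
    ha_sum hb_sum ha_tsum hb_tsum fun z y => ?_⟩
  have hsum : Summable fun i => a i z * b i y := by
    refine Summable.of_norm_bounded ((ha_sum z).add (hb_sum y)) fun i => ?_
    rw [Real.norm_eq_abs, abs_le]
    constructor <;> nlinarith [sq_nonneg (a i z + b i y), sq_nonneg (a i z - b i y),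
      sq_nonneg (a i z), sq_nonneg (b i y)]
  have hfib : ∀ n, HasSum (fun k : Fin (2 ^ n + 1) => a ⟨n, k⟩ z * b ⟨n, k⟩ y)
      (dyadicIncrement hB (Δ z) n (dyadicCell B n y)) := by
    intro n
    convert hasSum_fintype (fun k : Fin (2 ^ n + 1) => a ⟨n, k⟩ z * b ⟨n, k⟩ y) using 1
    simp [hb_eq, a, cell, (hw n).ne']
  have hlevels := (hsum.hasSum.sigma hfib).tendsto_sum_nat.comp (tendsto_add_atTop_nat 1)
  have heq : (∑' i, a i z * b i y) = Δ z y := by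
    refine tendsto_nhds_unique hlevels ((hlim z y).congr fun n => ?_)
    exact (sum_dyadicIncrement hB (Δ z) n y).symm
  exact heq ▸ hsum.hasSum

/-- a function `Δ` on `[−B,B] × [−B,B]` that is `α`-Hölder continuous with
exponent `α > 1/2` admits an ILE. -/
theorem stmt12 (B : ℝ) (hB : 0 < B)
    (Δ : Set.Icc (-B) B → Set.Icc (-B) B → ℝ)
    (α : ℝ) (hα : 1 / 2 < α)
    (L : ℝ) (hL : 0 < L)
    (hHolder : ∀ z z' y y' : Set.Icc (-B) B,
      |Δ z y - Δ z' y'| ≤ L * (|(z : ℝ) - (z' : ℝ)| + |(y : ℝ) - (y' : ℝ)|) ^ α) :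
    ∃ c : ℝ, Nonempty (ILEWith Δ c) := by
  have hα0 : 0 < α := by linarith
  have hmodulus : ∀ {u : ℕ → ℝ}, Tendsto u atTop (𝓝 0) →
      Tendsto (fun n => L * u n ^ α) atTop (𝓝 0) := fun hu => by
    simpa [Real.zero_rpow hα0.ne'] using (hu.rpow_const (Or.inr hα0.le)).const_mul L
  have hHolder_left : ∀ z z' y, |Δ z y - Δ z' y| ≤ L * |(z : ℝ) - z'| ^ α := fun z z' y => by
    simpa using hHolder z z' y y
  have hHolder_right : ∀ z y y', |Δ z y - Δ z y'| ≤ L * |(y : ℝ) - y'| ^ α := fun z y y' => by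
    simpa using hHolder z z y y'
  let o : Set.Icc (-B) B := ⟨0, by constructor <;> linarith⟩
  set r : ℝ := (1 / 2) ^ α with hr
  have hr0 : 0 < r := by positivity
  have hr2 : 2 * r ^ 2 < 1 := by
    have : r < (1 / 2) ^ (1 / 2 : ℝ) :=
      Real.rpow_lt_rpow_of_exponent_gt (by norm_num) (by norm_num) hα
    have hsq : ((1 / 2 : ℝ) ^ (1 / 2 : ℝ)) ^ 2 = 1 / 2 := by
      rw [← Real.sqrt_eq_rpow, Real.sq_sqrt (by norm_num)]
    nlinarith [pow_lt_pow_left₀ this hr0.le two_ne_zero]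
  have hscale : ∀ n : ℕ, L * (2 * B / 2 ^ n) ^ α = L * (2 * B) ^ α * r ^ n := fun n => by
    rw [hr, Real.rpow_pow_comm (by norm_num), mul_assoc,
      ← Real.mul_rpow (by positivity) (by positivity), one_div, inv_pow, div_eq_mul_inv]
  have hbound : ∀ z y, |Δ z y| ≤ |Δ o o| + L * (2 * B) ^ α := fun z y => by
    have h1 := hHolder z o y o
    have h2 : |(z : ℝ) - (o : ℝ)| + |(y : ℝ) - (o : ℝ)| ≤ 2 * B := by
      have hz : |(z : ℝ)| ≤ B := abs_le.2 z.2
      have hy : |(y : ℝ)| ≤ B := abs_le.2 y.2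
      simp only [o, sub_zero]
      linarith
    have h3 : L * (|(z : ℝ) - (o : ℝ)| + |(y : ℝ) - (o : ℝ)|) ^ α ≤ L * (2 * B) ^ α := by
      gcongr
    linarith [abs_sub_abs_le_abs_sub (Δ z y) (Δ o o)]
  refine exists_ILEWith_of_dyadicIncrement_le hB (M := |Δ o o| + L * (2 * B) ^ α) (r := r)
    hr0 hr2 (fun y => ?_) (fun z n k => ?_) (fun z y => ?_)
  · refine Continuous.measurable (continuous_iff_seqContinuous.2 fun u z hu => ?_)
    rw [tendsto_iff_dist_tendsto_zero] at hu ⊢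
    exact squeeze_zero (fun _ => dist_nonneg) (fun n => hHolder_left (u n) z y) (hmodulus hu)
  · cases n with
    | zero => simpa [dyadicIncrement] using hbound z _
    | succ n =>
      calc |dyadicIncrement hB (Δ z) (n + 1) k|
          ≤ L * (2 * B / 2 ^ (n + 1)) ^ α := (hHolder_right z _ _).trans (by
            gcongr; exact abs_dyadicNode_sub_le hB n k)
        _ = L * (2 * B) ^ α * r ^ (n + 1) := hscale _
        _ ≤ (|Δ o o| + L * (2 * B) ^ α) * r ^ (n + 1) := by
            gcongr; exact le_add_of_nonneg_left (abs_nonneg _)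
  · have hnode : Tendsto (fun n : ℕ => 2 * B / 2 ^ n) atTop (𝓝 0) :=
      tendsto_const_nhds.div_atTop (tendsto_pow_atTop_atTop_of_one_lt one_lt_two)
    rw [tendsto_iff_dist_tendsto_zero]
    refine squeeze_zero (fun _ => dist_nonneg) (fun n => ?_) (hmodulus hnode)
    refine (hHolder_right z _ _).trans ?_
    gcongr
    exact abs_dyadicNode_dyadicCell_sub_le hB n y
end
end

section
/- (Right composition preserves ILE) Let Z, Y, Z̄, Ȳ be Polish spaces and let Δ̄ : Z̄ × Ȳ → ℝ admit an ILE with constant c_Δ̄. Let A : Z → Z̄ and B : Y → Ȳ be continuous maps, and let α : Z → ℝ, β : Y → ℝ be continuous with sup_{z ∈ Z} |α(z)| ≤ ᾱ and sup_{y ∈ Y} |β(y)| ≤ β̄ for some ᾱ, β̄ > 0. Then the function Δ(z, y) = α(z) · Δ̄(A(z), B(y)) · β(y) admits an ILE with constant c_Δ ≤ ᾱ β̄ c_Δ̄. -/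
open RealInnerProductSpace

noncomputable section

/-- right composition preserves the ILE property: if `Δ̄` admits an ILE with
constant `c̄`, `A, B` are continuous and `α, β` are continuous and bounded by `ᾱ, β̄`, then
`Δ(z,y) = α(z) Δ̄(A z, B y) β(y)` admits an ILE with constant at most `ᾱ β̄ c̄`. -/
theorem stmt15 {Z Y Zbar Ybar : Type*}
    [TopologicalSpace Z] [PolishSpace Z] [MeasurableSpace Z] [BorelSpace Z]
    [TopologicalSpace Y] [PolishSpace Y] [MeasurableSpace Y] [BorelSpace Y]
    [TopologicalSpace Zbar] [PolishSpace Zbar] [MeasurableSpace Zbar] [BorelSpace Zbar]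
    [TopologicalSpace Ybar] [PolishSpace Ybar] [MeasurableSpace Ybar] [BorelSpace Ybar]
    (Δbar : Zbar → Ybar → ℝ) (cbar : ℝ) (hILE : Nonempty (ILEWith Δbar cbar))
    (A : Z → Zbar) (hA : Continuous A) (B : Y → Ybar) (hB : Continuous B)
    (α : Z → ℝ) (hα : Continuous α) (β : Y → ℝ) (hβ : Continuous β)
    (αbar βbar : ℝ) (hαbar : 0 < αbar) (hβbar : 0 < βbar)
    (hαb : ∀ z, |α z| ≤ αbar) (hβb : ∀ y, |β y| ≤ βbar) :
    Nonempty (ILEWith (fun z y => α z * Δbar (A z) (B y) * β y) (αbar * βbar * cbar)) := by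
  obtain ⟨h⟩ := hILE
  obtain ⟨H, ψ, φ, hψ, hφ, hφn, hψn, hΔ⟩ := h
  have : SecondCountableTopology H := UniformSpace.secondCountable_of_separable H
  refine ⟨{
    H := H
    ψ := fun z => (βbar * α z) • ψ (A z)
    φ := fun y => (βbar⁻¹ * β y) • φ (B y)
    meas_ψ := (hα.measurable.const_mul βbar).smul (hψ.comp hA.measurable)
    meas_φ := (hβ.measurable.const_mul βbar⁻¹).smul (hφ.comp hB.measurable)
    norm_φ := fun y => ?_
    norm_ψ := fun z => ?_
    loss_eq := fun z y => ?_ }⟩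
  · have hscale : βbar⁻¹ * |β y| ≤ 1 := by
      rw [inv_mul_le_iff₀ hβbar, mul_one]
      exact hβb y
    rw [norm_smul, Real.norm_eq_abs, abs_mul, abs_of_pos (inv_pos.mpr hβbar)]
    exact mul_le_one₀ hscale (norm_nonneg _) (hφn _)
  · rw [norm_smul, Real.norm_eq_abs, abs_mul, abs_of_pos hβbar, mul_comm αbar]
    gcongr
    · exact hαb z
    · exact hψn (A z)
  · simp only [hΔ, real_inner_smul_left, real_inner_smul_right]
    field_simp
end
end

section
/- (Sums of ILE losses are ILE) Let Δ₁ : Z₁ × Y₁ → ℝ and Δ₂ : Z₂ × Y₂ → ℝ both admit an ILE. Then the function Δ : (Z₁ × Z₂) × (Y₁ × Y₂) → ℝ defined by Δ((z₁, z₂), (y₁, y₂)) = Δ₁(z₁, y₁) + Δ₂(z₂, y₂) admits an ILE. -/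
open RealInnerProductSpace

noncomputable section

/-- A loss admits an ILE if it admits an ILE for some constant. -/
def AdmitsILE {Z Y : Type*} [MeasurableSpace Z] [MeasurableSpace Y]
    (Δ : Z → Y → ℝ) : Prop :=
  ∃ c : ℝ, Nonempty (ILEWith Δ c)

/-- The sum of two embeddings is embedded in the `L²` product of the two Hilbert spaces; the factor
`2` is moved from one side to the other to keep `φ` in the unit ball. -/
def ILEWith.add {Z₁ Y₁ Z₂ Y₂ : Type*}
    [MeasurableSpace Z₁] [MeasurableSpace Y₁] [MeasurableSpace Z₂] [MeasurableSpace Y₂]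
    {Δ₁ : Z₁ → Y₁ → ℝ} {Δ₂ : Z₂ → Y₂ → ℝ} {c₁ c₂ : ℝ}
    (e₁ : ILEWith Δ₁ c₁) (e₂ : ILEWith Δ₂ c₂) :
    ILEWith (fun (z : Z₁ × Z₂) (y : Y₁ × Y₂) => Δ₁ z.1 y.1 + Δ₂ z.2 y.2) (2 * (c₁ + c₂)) :=
  letI := e₁.normgrp
  letI := e₁.innsp
  letI := e₁.mH
  haveI := e₁.cpl
  haveI := e₁.sep
  haveI := e₁.bH
  letI := e₂.normgrp
  letI := e₂.innsp
  letI := e₂.mH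
  haveI := e₂.cpl
  haveI := e₂.sep
  haveI := e₂.bH
  haveI : SecondCountableTopology e₁.H := UniformSpace.secondCountable_of_separable _
  haveI : SecondCountableTopology e₂.H := UniformSpace.secondCountable_of_separable _
  have norm_le {x : e₁.H} {y : e₂.H} {a b : ℝ} (hx : ‖x‖ ≤ a) (hy : ‖y‖ ≤ b) :
      ‖WithLp.toLp 2 (x, y)‖ ≤ a + b := by
    have h := WithLp.prod_norm_sq_eq_of_L2 (WithLp.toLp 2 (x, y))
    have hx0 := norm_nonneg x
    have hy0 := norm_nonneg y
    refine le_trans (abs_le_of_sq_le_sq' ?_ (add_nonneg hx0 hy0)).2 (add_le_add hx hy)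
    rw [h]
    change ‖x‖ ^ 2 + ‖y‖ ^ 2 ≤ _
    nlinarith [mul_nonneg hx0 hy0]
  { H := WithLp 2 (e₁.H × e₂.H)
    ψ := fun z => (2 : ℝ) • WithLp.toLp 2 (e₁.ψ z.1, e₂.ψ z.2)
    φ := fun y => (2⁻¹ : ℝ) • WithLp.toLp 2 (e₁.φ y.1, e₂.φ y.2)
    meas_ψ := (continuous_const_smul (2 : ℝ)).measurable.comp ((WithLp.measurable_toLp 2 _).comp
      ((e₁.meas_ψ.comp measurable_fst).prodMk (e₂.meas_ψ.comp measurable_snd)))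
    meas_φ := (continuous_const_smul (2⁻¹ : ℝ)).measurable.comp ((WithLp.measurable_toLp 2 _).comp
      ((e₁.meas_φ.comp measurable_fst).prodMk (e₂.meas_φ.comp measurable_snd)))
    norm_φ := fun y => by
      rw [norm_smul, Real.norm_of_nonneg (by norm_num)]
      linarith [norm_le (e₁.norm_φ y.1) (e₂.norm_φ y.2)]
    norm_ψ := fun z => by
      rw [norm_smul, Real.norm_of_nonneg (by norm_num)]
      linarith [norm_le (e₁.norm_ψ z.1) (e₂.norm_ψ z.2)]
    loss_eq := fun z y => by
      rw [real_inner_smul_left, real_inner_smul_right, WithLp.prod_inner_apply,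
        e₁.loss_eq, e₂.loss_eq]
      simp }

/-- the sum of two ILE losses is an ILE loss on the product spaces. -/
theorem stmt16 {Z₁ Y₁ Z₂ Y₂ : Type*}
    [MeasurableSpace Z₁] [MeasurableSpace Y₁] [MeasurableSpace Z₂] [MeasurableSpace Y₂]
    (Δ₁ : Z₁ → Y₁ → ℝ) (Δ₂ : Z₂ → Y₂ → ℝ)
    (h₁ : AdmitsILE Δ₁) (h₂ : AdmitsILE Δ₂) :
    AdmitsILE (fun (z : Z₁ × Z₂) (y : Y₁ × Y₂) => Δ₁ z.1 y.1 + Δ₂ z.2 y.2) := by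
  obtain ⟨c₁, ⟨e₁⟩⟩ := h₁
  obtain ⟨c₂, ⟨e₂⟩⟩ := h₂
  exact ⟨_, ⟨e₁.add e₂⟩⟩
end
end

section
/- (Products of ILE losses are ILE) Let Δ₁ : Z₁ × Y₁ → ℝ and Δ₂ : Z₂ × Y₂ → ℝ both admit an ILE. Then the function Δ : (Z₁ × Z₂) × (Y₁ × Y₂) → ℝ defined by Δ((z₁, z₂), (y₁, y₂)) = Δ₁(z₁, y₁) · Δ₂(z₂, y₂) admits an ILE. -/
open RealInnerProductSpace

noncomputable section

open scoped TensorProduct in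
/-- Pure tensors depend jointly continuously on their factors. -/
theorem continuous_tmul_prod {E F : Type*} [NormedAddCommGroup E] [InnerProductSpace ℝ E]
    [NormedAddCommGroup F] [InnerProductSpace ℝ F] :
    Continuous fun p : E × F => p.1 ⊗ₜ[ℝ] p.2 :=
  (TensorProduct.mkL (𝕜 := ℝ) (E := E) (F := F)).continuous₂

open scoped TensorProduct in
/-- The tensor product of two separable inner product spaces is separable. -/
theorem separableSpace_tensorProduct {E F : Type*} [NormedAddCommGroup E] [InnerProductSpace ℝ E]
    [NormedAddCommGroup F] [InnerProductSpace ℝ F] [TopologicalSpace.SeparableSpace E]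
    [TopologicalSpace.SeparableSpace F] : TopologicalSpace.SeparableSpace (E ⊗[ℝ] F) := by
  rw [← TopologicalSpace.isSeparable_univ_iff]
  have h := (TopologicalSpace.isSeparable_range
    (continuous_tmul_prod (E := E) (F := F))).span (R := ℝ)
  have hspan : Submodule.span ℝ (Set.range fun p : E × F => p.1 ⊗ₜ[ℝ] p.2) = ⊤ := by
    rw [← TensorProduct.span_tmul_eq_top]
    congr 1
    ext t
    simp
  rwa [hspan, Submodule.top_coe] at h

/-- the product of two ILE losses is an ILE loss on the product spaces. -/
theorem stmt17 {Z₁ Y₁ Z₂ Y₂ : Type*}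
    [MeasurableSpace Z₁] [MeasurableSpace Y₁] [MeasurableSpace Z₂] [MeasurableSpace Y₂]
    (Δ₁ : Z₁ → Y₁ → ℝ) (Δ₂ : Z₂ → Y₂ → ℝ)
    (h₁ : AdmitsILE Δ₁) (h₂ : AdmitsILE Δ₂) :
    AdmitsILE (fun (z : Z₁ × Z₂) (y : Y₁ × Y₂) => Δ₁ z.1 y.1 * Δ₂ z.2 y.2) := by
  obtain ⟨c₁, ⟨e₁⟩⟩ := h₁
  obtain ⟨c₂, ⟨e₂⟩⟩ := h₂
  obtain ⟨H₁, ψ₁, φ₁, mψ₁, mφ₁, nφ₁, nψ₁, eq₁⟩ := e₁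
  obtain ⟨H₂, ψ₂, φ₂, mψ₂, mφ₂, nφ₂, nψ₂, eq₂⟩ := e₂
  have : TopologicalSpace.SeparableSpace (TensorProduct ℝ H₁ H₂) := separableSpace_tensorProduct
  let K := UniformSpace.Completion (TensorProduct ℝ H₁ H₂)
  let _ : MeasurableSpace K := borel K
  have : BorelSpace K := ⟨rfl⟩
  have hT : Measurable fun p : H₁ × H₂ => ((p.1 ⊗ₜ[ℝ] p.2 : TensorProduct ℝ H₁ H₂) : K) :=
    ((UniformSpace.Completion.continuous_coe _).comp continuous_tmul_prod).measurable
  refine ⟨c₁ * c₂, ⟨{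
    H := K
    ψ := fun z => ((ψ₁ z.1 ⊗ₜ[ℝ] ψ₂ z.2 : TensorProduct ℝ H₁ H₂) : K)
    φ := fun y => ((φ₁ y.1 ⊗ₜ[ℝ] φ₂ y.2 : TensorProduct ℝ H₁ H₂) : K)
    meas_ψ := hT.comp (mψ₁.prodMap mψ₂)
    meas_φ := hT.comp (mφ₁.prodMap mφ₂)
    norm_φ := fun y => ?_
    norm_ψ := fun z => ?_
    loss_eq := fun z y => ?_ }⟩⟩
  · rw [UniformSpace.Completion.norm_coe, TensorProduct.norm_tmul]
    exact mul_le_one₀ (nφ₁ _) (norm_nonneg _) (nφ₂ _)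
  · rw [UniformSpace.Completion.norm_coe, TensorProduct.norm_tmul]
    exact mul_le_mul (nψ₁ _) (nψ₂ _) (norm_nonneg _) ((norm_nonneg _).trans (nψ₁ z.1))
  · rw [UniformSpace.Completion.inner_coe, TensorProduct.inner_tmul, eq₁, eq₂]
end
end

section
/- (L²-Boosting spectral filter bounds) Let κ > 0, let 0 < ν < 1/κ², let t ≥ 1 be a natural number and set λ = 1/t. Define η_λ(σ) = ν Σ_{j=0}^{t} (1 − νσ)^j for σ ∈ (0, κ²]. Then for every σ ∈ (0, κ²] one has (σ + λ) η_λ(σ) ≤ 1 + 2ν and (1 − σ η_λ(σ))(σ + λ) ≤ (e^{ν−1}/ν) λ. -/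
/-- the L²-Boosting spectral filter
`η_λ(σ) = ν Σ_{j=0}^{t} (1 − νσ)^j` with step-size `0 < ν < 1/κ²` and `λ = 1/t` satisfies
the spectral filter bounds `(σ + λ) η_λ(σ) ≤ 1 + 2ν` and
`(1 − σ η_λ(σ))(σ + λ) ≤ (e^{ν−1}/ν) λ` for all `σ ∈ (0, κ²]`. -/
theorem stmt18 (κ : ℝ) (hκ : 0 < κ) (ν : ℝ) (hν0 : 0 < ν) (hν : ν < 1 / κ ^ 2)
    (t : ℕ) (ht : 1 ≤ t) :
    ∀ σ ∈ Set.Ioc (0 : ℝ) (κ ^ 2),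
      (σ + 1 / (t : ℝ)) * (ν * ∑ j ∈ Finset.range (t + 1), (1 - ν * σ) ^ j) ≤ 1 + 2 * ν ∧
      (1 - σ * (ν * ∑ j ∈ Finset.range (t + 1), (1 - ν * σ) ^ j)) * (σ + 1 / (t : ℝ)) ≤
        (Real.exp (ν - 1) / ν) * (1 / (t : ℝ)) := by
  rintro σ ⟨hσ0, hσ⟩
  have ht0 : (0 : ℝ) < t := by exact_mod_cast ht
  have ht1 : (1 : ℝ) ≤ t := by exact_mod_cast ht
  have hx0 : 0 < ν * σ := mul_pos hν0 hσ0
  have hx1 : ν * σ ≤ 1 := by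
    rw [lt_div_iff₀ (by positivity)] at hν
    nlinarith
  have hbase : 0 ≤ 1 - ν * σ := by linarith
  have hgeom : σ * (ν * ∑ j ∈ Finset.range (t + 1), (1 - ν * σ) ^ j)
      = 1 - (1 - ν * σ) ^ (t + 1) := by
    linear_combination -geom_sum_mul (1 - ν * σ) (t + 1)
  have hpow : 0 ≤ (1 - ν * σ) ^ (t + 1) := pow_nonneg hbase _
  constructor
  · have hsum : ∑ j ∈ Finset.range (t + 1), (1 - ν * σ) ^ j ≤ 2 * t := by
      calc ∑ j ∈ Finset.range (t + 1), (1 - ν * σ) ^ j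
          ≤ ∑ _j ∈ Finset.range (t + 1), (1 : ℝ) :=
            Finset.sum_le_sum fun j _ => pow_le_one₀ hbase (by linarith)
        _ = t + 1 := by simp
        _ ≤ 2 * t := by linarith
    have hη : 1 / (t : ℝ) * (ν * ∑ j ∈ Finset.range (t + 1), (1 - ν * σ) ^ j) ≤ 2 * ν := by
      rw [one_div_mul_eq_div, div_le_iff₀ ht0]
      nlinarith
    rw [add_mul, hgeom]
    linarith
  · rw [hgeom, sub_sub_cancel]
    have hexp : (1 - ν * σ) ^ (t + 1) ≤ Real.exp (-(t * (ν * σ))) := by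
      calc (1 - ν * σ) ^ (t + 1)
          ≤ (1 - ν * σ) ^ t := pow_le_pow_of_le_one hbase (by linarith) (Nat.le_succ t)
        _ ≤ Real.exp (-(ν * σ)) ^ t := pow_le_pow_left₀ hbase (Real.one_sub_le_exp_neg _) t
        _ = Real.exp (-(t * (ν * σ))) := by rw [← Real.exp_nat_mul, mul_neg]
    have hlin : t * (ν * σ) + ν ≤ Real.exp (t * (ν * σ) + ν - 1) := by
      linarith [Real.add_one_le_exp (t * (ν * σ) + ν - 1)]
    have hmain : (1 - ν * σ) ^ (t + 1) * (t * (ν * σ) + ν) ≤ Real.exp (ν - 1) := by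
      calc (1 - ν * σ) ^ (t + 1) * (t * (ν * σ) + ν)
          ≤ Real.exp (-(t * (ν * σ))) * Real.exp (t * (ν * σ) + ν - 1) :=
            mul_le_mul hexp hlin (by positivity) (Real.exp_nonneg _)
        _ = Real.exp (ν - 1) := by
            rw [← Real.exp_add]
            ring_nf
    rw [div_mul_div_comm, mul_one, le_div_iff₀ (by positivity)]
    refine le_of_eq_of_le ?_ hmain
    field_simp
end
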